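/- arXiv:2011.04544 — 2 statements merged into one kernel-verified Lean document; each statement's English description precedes it below -/
import Mathlib

section
/- Let f : ℝ → ℝ be Lipschitz continuous on the interval [-1, 1]. For each n ≥ 1 let p_n be the polynomial of degree at most n interpolating f at the n+1 Chebyshev points cos(jπ/n), 0 ≤ j ≤ n. Then the sequence of Chebyshev interpolants p_n converges to f uniformly on [-1, 1], i.e. sup_{x ∈ [-1,1]} |f(x) − p_n(x)| → 0 as n → ∞. -/
/-- The Chebyshev interpolant of degree at most `n` of a function `f : ℝ → ℝ`:
the unique polynomial of degree at most `n` agreeing with `f` at the `n+1`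
Chebyshev points `cos(jπ/n)`, `0 ≤ j ≤ n`, given by the Lagrange interpolation
formula. -/
noncomputable def chebInterpolant (n : ℕ) (f : ℝ → ℝ) : Polynomial ℝ :=
  Lagrange.interpolate (Finset.range (n + 1))
    (fun j : ℕ => Real.cos ((j : ℝ) * Real.pi / n))
    (fun j : ℕ => f (Real.cos ((j : ℝ) * Real.pi / n)))

open MeasureTheory AddCircle Filter Polynomial

theorem fourierCoeff_comp_add_right {T : ℝ} [Fact (0 < T)] (F : AddCircle T → ℂ)
    (h : AddCircle T) (k : ℤ) :
    fourierCoeff (fun x => F (x + h)) k = fourier k h * fourierCoeff F k := by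
  unfold fourierCoeff
  rw [← integral_add_right_eq_self (μ := haarAddCircle)
    (fun t : AddCircle T => fourier (-k) t • F t) h, ← integral_const_mul]
  refine integral_congr_ae (Eventually.of_forall fun t => ?_)
  have hadd : (fourier (-k) (t + h) : ℂ) = fourier (-k) t * fourier (-k) h := by
    simp only [fourier_apply, smul_add, toCircle_add, Circle.coe_mul]
  have hinv : (fourier k h : ℂ) * fourier (-k) h = 1 := by
    rw [← fourier_add, add_neg_cancel, fourier_zero]
  simp only [smul_eq_mul, hadd]
  linear_combination (-(fourier (-k) t * F (t + h))) * hinv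

theorem sum_sq_norm_fourierCoeff_le {T C : ℝ} [Fact (0 < T)] (G : C(AddCircle T, ℂ))
    (hG : ∀ x, ‖G x‖ ≤ C) (s : Finset ℤ) :
    ∑ k ∈ s, ‖fourierCoeff G k‖ ^ 2 ≤ C ^ 2 := by
  have hsum := hasSum_sq_fourierCoeff (ContinuousMap.toLp (E := ℂ) 2 haarAddCircle ℂ G)
  simp only [fourierCoeff_toLp] at hsum
  refine (sum_le_hasSum s (fun _ _ => by positivity) hsum).trans ?_
  have hintegral : ∫ t, ‖ContinuousMap.toLp (E := ℂ) 2 haarAddCircle ℂ G t‖ ^ 2 ∂haarAddCircle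
      = ∫ t, ‖G t‖ ^ 2 ∂(haarAddCircle (T := T)) := by
    refine integral_congr_ae ?_
    filter_upwards [ContinuousMap.coeFn_toLp (p := 2) (𝕜 := ℂ) (haarAddCircle (T := T)) G]
      with t ht
    rw [ht]
  rw [hintegral]
  have hle : ∫ t, ‖G t‖ ^ 2 ∂(haarAddCircle (T := T)) ≤ ∫ _, C ^ 2 ∂(haarAddCircle (T := T)) := by
    refine integral_mono ?_ (integrable_const _) fun t => ?_
    · exact (Continuous.integrable_of_hasCompactSupport (by fun_prop)
        (HasCompactSupport.of_compactSpace _))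
    · exact pow_le_pow_left₀ (norm_nonneg _) (hG t) 2
  simpa using hle

theorem le_norm_fourier_sub_one {T : ℝ} [hT : Fact (0 < T)] {k : ℤ} {h : ℝ}
    (hk : |(k : ℝ)| * |h| ≤ T / 2) :
    4 * |(k : ℝ)| * |h| / T ≤ ‖(fourier k (h : AddCircle T) : ℂ) - 1‖ := by
  have hT0 := hT.out
  have hπ := Real.pi_pos
  have hexp : (fourier k (h : AddCircle T) : ℂ)
      = Complex.exp (Complex.I * ((2 * Real.pi * k * h / T : ℝ) : ℂ)) := by
    rw [fourier_coe_apply]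
    congr 1
    push_cast
    ring
  have habs : |2 * Real.pi * k * h / T / 2| = Real.pi * (|(k : ℝ)| * |h|) / T := by
    rw [show 2 * Real.pi * k * h / T / 2 = Real.pi * (k * h) / T by ring, abs_div, abs_mul,
      abs_mul, abs_of_pos hπ, abs_of_pos hT0]
  have hsin := Real.mul_abs_le_abs_sin (x := 2 * Real.pi * k * h / T / 2) (by
    rw [habs, div_le_iff₀ hT0]
    nlinarith)
  rw [hexp, Complex.norm_exp_I_mul_ofReal_sub_one, Real.norm_eq_abs, abs_mul, abs_two]
  rw [habs] at hsin
  calc 4 * |(k : ℝ)| * |h| / T = 2 * (2 / Real.pi * (Real.pi * (|(k : ℝ)| * |h|) / T)) := by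
        field_simp
        ring
    _ ≤ _ := by linarith

theorem sum_sq_mul_sq_norm_fourierCoeff_le {T K : ℝ} [hT : Fact (0 < T)] (F : C(AddCircle T, ℂ))
    (hF : ∀ (x : AddCircle T) (h : ℝ), ‖F (x + h) - F x‖ ≤ K * |h|) (s : Finset ℤ) :
    ∑ k ∈ s, (k : ℝ) ^ 2 * ‖fourierCoeff F k‖ ^ 2 ≤ (K * T / 4) ^ 2 := by
  have hT0 := hT.out
  obtain ⟨N, hN⟩ : ∃ N : ℕ, ∀ k ∈ s, |(k : ℝ)| ≤ N := by
    refine ⟨s.sup Int.natAbs, fun k hk => ?_⟩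
    rw [← Int.cast_abs, Int.abs_eq_natAbs, Int.cast_natCast]
    exact_mod_cast Finset.le_sup (f := Int.natAbs) hk
  set h : ℝ := T / (2 * (N + 1)) with hh
  have hpos : 0 < h := by positivity
  let G : C(AddCircle T, ℂ) := F.comp (ContinuousMap.addRight (h : AddCircle T)) - F
  have hcoeff (k : ℤ) : fourierCoeff G k = (fourier k (h : AddCircle T) - 1) * fourierCoeff F k := by
    have hintegral (H : C(AddCircle T, ℂ)) : Integrable (⇑H) haarAddCircle :=
      H.continuous.integrable_of_hasCompactSupport (HasCompactSupport.of_compactSpace _)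
    have hadd := fourierCoeff.add (hintegral G) (hintegral F)
    have hGF : (⇑G + ⇑F) = fun x => F (x + h) := by
      ext x
      simp [G]
    rw [hGF] at hadd
    have := congrFun hadd k
    rw [fourierCoeff_comp_add_right, Pi.add_apply] at this
    linear_combination -this
  have hbound := sum_sq_norm_fourierCoeff_le G (C := K * h)
    (fun x => by simpa [G, abs_of_pos hpos] using hF x h) s
  have hterm : ∀ k ∈ s, (4 * h / T) ^ 2 * ((k : ℝ) ^ 2 * ‖fourierCoeff F k‖ ^ 2)
      ≤ ‖fourierCoeff G k‖ ^ 2 := by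
    intro k hk
    have hkh : |(k : ℝ)| * |h| ≤ T / 2 := by
      rw [abs_of_pos hpos]
      calc |(k : ℝ)| * h ≤ (N + 1) * h := by
            gcongr
            linarith [hN k hk]
        _ = T / 2 := by
            rw [hh]
            field_simp
    have hle := le_norm_fourier_sub_one hkh
    rw [hcoeff, norm_mul, mul_pow]
    calc (4 * h / T) ^ 2 * ((k : ℝ) ^ 2 * ‖fourierCoeff F k‖ ^ 2)
        = (4 * |(k : ℝ)| * |h| / T) ^ 2 * ‖fourierCoeff F k‖ ^ 2 := by
          rw [← sq_abs (k : ℝ), abs_of_pos hpos]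
          ring
      _ ≤ _ := by gcongr
  have hsum := (Finset.sum_le_sum hterm).trans hbound
  rw [← Finset.mul_sum] at hsum
  refine le_of_mul_le_mul_left (hsum.trans_eq ?_) (by positivity : 0 < (4 * h / T) ^ 2)
  field_simp

/-- Bernstein's theorem in the Lipschitz case: the Fourier series converges absolutely. -/
theorem summable_fourierCoeff_of_lipschitz {T K : ℝ} [Fact (0 < T)] (F : C(AddCircle T, ℂ))
    (hF : ∀ (x : AddCircle T) (h : ℝ), ‖F (x + h) - F x‖ ≤ K * |h|) :
    Summable (fourierCoeff F) := by
  have hsq : Summable fun k : ℤ => (k : ℝ) ^ 2 * ‖fourierCoeff F k‖ ^ 2 :=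
    summable_of_sum_le (fun _ => by positivity) (sum_sq_mul_sq_norm_fourierCoeff_le F hF)
  have hinv : Summable fun k : ℤ => 1 / (k : ℝ) ^ 2 :=
    Real.summable_one_div_int_pow.mpr one_lt_two
  refine Summable.of_norm_bounded_eventually (hinv.add hsq) ?_
  filter_upwards [(Set.finite_singleton (0 : ℤ)).compl_mem_cofinite] with k hk
  have hk0 : (k : ℝ) ≠ 0 := by exact_mod_cast hk
  have hamgm := two_mul_le_add_sq (1 / (k : ℝ) * 1) (k * ‖fourierCoeff F k‖)
  have : 2 * (1 / (k : ℝ) * 1) * (k * ‖fourierCoeff F k‖) = 2 * ‖fourierCoeff F k‖ := by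
    field_simp
  rw [this, mul_one, div_pow, one_pow, mul_pow] at hamgm
  linarith [norm_nonneg (fourierCoeff F k)]

/-- A function which is Lipschitz on `[-1, 1]` is the sum of an absolutely convergent Chebyshev
series, here indexed by `ℤ`. -/
theorem exists_hasSum_chebyshev_of_lipschitzOnWith {f : ℝ → ℝ} {K : NNReal}
    (hf : LipschitzOnWith K f (Set.Icc (-1 : ℝ) 1)) :
    ∃ r : ℤ → ℝ, Summable r ∧ ∀ x ∈ Set.Icc (-1 : ℝ) 1,
      HasSum (fun k => r k * (Chebyshev.T ℝ k).eval x) (f x) := by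
  have : Fact (0 < 2 * Real.pi) := ⟨Real.two_pi_pos⟩
  have hcos (x : Real.Angle) : x.cos ∈ Set.Icc (-1 : ℝ) 1 := by
    induction x using Real.Angle.induction_on with
    | h x => exact Real.cos_mem_Icc x
  let F : C(AddCircle (2 * Real.pi), ℂ) :=
    ⟨fun x => (f (Real.Angle.cos x) : ℂ), Complex.continuous_ofReal.comp
      (hf.continuousOn.comp_continuous Real.Angle.continuous_cos hcos)⟩
  have hFcoe (x : ℝ) : F (x : AddCircle (2 * Real.pi)) = (f (Real.cos x) : ℂ) := rfl
  have hlip (x : AddCircle (2 * Real.pi)) (h : ℝ) : ‖F (x + h) - F x‖ ≤ K * |h| := by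
    induction x using QuotientAddGroup.induction_on with
    | H x =>
      rw [← AddCircle.coe_add, hFcoe, hFcoe, ← Complex.ofReal_sub, Complex.norm_real]
      refine (hf.norm_sub_le (Real.cos_mem_Icc _) (Real.cos_mem_Icc _)).trans ?_
      gcongr
      simpa using Real.abs_cos_sub_cos_le (x + h) x
  have hsum := summable_fourierCoeff_of_lipschitz F hlip
  refine ⟨fun k => (fourierCoeff F k).re, (Complex.hasSum_re hsum.hasSum).summable,
    fun x hx => ?_⟩
  obtain ⟨θ, rfl⟩ : ∃ θ, Real.cos θ = x := ⟨Real.arccos x, Real.cos_arccos hx.1 hx.2⟩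
  have hpos := has_pointwise_sum_fourier_series_of_summable hsum (θ : AddCircle (2 * Real.pi))
  have hneg := has_pointwise_sum_fourier_series_of_summable hsum
    ((-θ : ℝ) : AddCircle (2 * Real.pi))
  rw [hFcoe] at hpos hneg
  rw [Real.cos_neg] at hneg
  have havg := Complex.hasSum_re ((hpos.add hneg).div_const 2)
  convert havg using 1
  · ext k
    have hk : (fourier k (θ : AddCircle (2 * Real.pi)) : ℂ)
        + fourier k ((-θ : ℝ) : AddCircle (2 * Real.pi)) = ((2 * Real.cos (k * θ) : ℝ) : ℂ) := by
      rw [fourier_coe_apply, fourier_coe_apply]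
      push_cast
      rw [Complex.two_cos]
      have : (Real.pi : ℂ) ≠ 0 := by exact_mod_cast Real.pi_ne_zero
      congr 2 <;> field_simp
    rw [Chebyshev.T_real_cos, smul_eq_mul, smul_eq_mul, ← mul_add, hk]
    rw [show fourierCoeff F k * ((2 * Real.cos (k * θ) : ℝ) : ℂ) / 2
      = fourierCoeff F k * ((Real.cos (k * θ) : ℝ) : ℂ) by push_cast; ring, Complex.re_mul_ofReal]
  · simp

theorem injOn_chebyshev_points {n : ℕ} (hn : n ≠ 0) :
    Set.InjOn (fun j : ℕ => Real.cos ((j : ℝ) * Real.pi / n)) (Finset.range (n + 1)) := by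
  have hn0 : (0 : ℝ) < n := by positivity
  refine Real.injOn_cos.comp (fun i _ j _ hij => ?_) fun j hj => ⟨by positivity, ?_⟩
  · have hπ := Real.pi_ne_zero
    field_simp at hij
    exact_mod_cast hij
  · have hj' : (j : ℝ) ≤ n := by
      exact_mod_cast Nat.lt_succ_iff.mp (Finset.mem_range.mp hj)
    rw [div_le_iff₀ hn0, mul_comm]
    gcongr

theorem chebInterpolant_eq_of_eval_eq {n : ℕ} (hn : n ≠ 0) {f : ℝ → ℝ} {p : ℝ[X]}
    (hp : p.degree ≤ n) (h : ∀ j ≤ n, p.eval (Real.cos ((j : ℝ) * Real.pi / n))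
      = f (Real.cos ((j : ℝ) * Real.pi / n))) :
    chebInterpolant n f = p := by
  refine (Lagrange.eq_interpolate_of_eval_eq _ (injOn_chebyshev_points hn) ?_ ?_).symm
  · rw [Finset.card_range]
    exact hp.trans_lt (by exact_mod_cast n.lt_succ_self)
  · intro j hj
    exact h j (Nat.lt_succ_iff.mp (Finset.mem_range.mp hj))

theorem chebInterpolant_chebyshev_T_of_natAbs_le {n : ℕ} (hn : n ≠ 0) {k : ℤ}
    (hk : k.natAbs ≤ n) :
    chebInterpolant n (fun x => (Chebyshev.T ℝ k).eval x) = Chebyshev.T ℝ k := by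
  refine chebInterpolant_eq_of_eval_eq hn ?_ fun _ _ => rfl
  rw [Chebyshev.degree_T]
  exact_mod_cast hk

theorem exists_natAbs_le_and_eq_add_mul {n : ℕ} (hn : n ≠ 0) (k : ℤ) :
    ∃ m l : ℤ, m.natAbs ≤ n ∧ k = m + l * (2 * n) := by
  have hn0 : (0 : ℤ) < n := by positivity
  have hdiv := Int.emod_add_mul_ediv k (2 * n)
  have h0 := Int.emod_nonneg k (b := 2 * n) (by positivity)
  have h1 := Int.emod_lt_of_pos k (b := 2 * n) (by positivity)
  by_cases h : k % (2 * n) ≤ n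
  · exact ⟨k % (2 * n), k / (2 * n), by omega, by linear_combination -hdiv⟩
  · exact ⟨k % (2 * n) - 2 * n, k / (2 * n) + 1, by omega, by linear_combination -hdiv⟩

/-- On the Chebyshev points each Chebyshev polynomial coincides with one of degree at most `n`. -/
theorem exists_chebInterpolant_chebyshev_T_eq {n : ℕ} (hn : n ≠ 0) (k : ℤ) :
    ∃ m : ℤ, chebInterpolant n (fun x => (Chebyshev.T ℝ k).eval x) = Chebyshev.T ℝ m := by
  obtain ⟨m, l, hm, rfl⟩ := exists_natAbs_le_and_eq_add_mul hn k
  refine ⟨m, chebInterpolant_eq_of_eval_eq hn ?_ fun j _ => ?_⟩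
  · rw [Chebyshev.degree_T]
    exact_mod_cast hm
  · rw [Chebyshev.T_real_cos, Chebyshev.T_real_cos,
      ← Real.cos_add_int_mul_two_pi (m * _) (l * j)]
    congr 1
    have : (n : ℝ) ≠ 0 := by exact_mod_cast hn
    push_cast
    field_simp

theorem hasSum_eval_chebInterpolant {ι : Type*} {n : ℕ} {f : ℝ → ℝ} {g : ι → ℝ → ℝ} {r : ι → ℝ}
    (h : ∀ x ∈ Set.Icc (-1 : ℝ) 1, HasSum (fun k => r k * g k x) (f x)) (x : ℝ) :
    HasSum (fun k => r k * (chebInterpolant n (g k)).eval x) ((chebInterpolant n f).eval x) := by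
  simp only [chebInterpolant, Lagrange.interpolate_apply, eval_finsetSum, eval_mul, eval_C,
    Finset.mul_sum, ← mul_assoc]
  exact hasSum_sum fun j _ => (h _ (Real.cos_mem_Icc _)).mul_right _

theorem abs_eval_chebyshev_T_sub_chebInterpolant_le {n : ℕ} (hn : n ≠ 0) (k : ℤ) {x : ℝ}
    (hx : x ∈ Set.Icc (-1 : ℝ) 1) :
    |(Chebyshev.T ℝ k).eval x
      - (chebInterpolant n (fun y => (Chebyshev.T ℝ k).eval y)).eval x|
      ≤ if k.natAbs ≤ n then 0 else 2 := by
  split_ifs with hk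
  · rw [chebInterpolant_chebyshev_T_of_natAbs_le hn hk, sub_self, abs_zero]
  · obtain ⟨m, hm⟩ := exists_chebInterpolant_chebyshev_T_eq hn k
    rw [hm]
    have hT (i : ℤ) := Chebyshev.abs_eval_T_real_le_one i (abs_le.mpr hx)
    linarith [abs_sub ((Chebyshev.T ℝ k).eval x) ((Chebyshev.T ℝ m).eval x), hT k, hT m]

/-- If `f : ℝ → ℝ` is Lipschitz continuous on `[-1, 1]`, then the Chebyshev
interpolants `p_n` of `f` converge to `f` uniformly on `[-1, 1]`. -/
theorem chebyshev_interpolants_tendstoUniformly_of_lipschitz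
    (f : ℝ → ℝ) (K : NNReal) (hf : LipschitzOnWith K f (Set.Icc (-1 : ℝ) 1)) :
    TendstoUniformlyOn (fun (n : ℕ) (x : ℝ) => (chebInterpolant n f).eval x) f
      Filter.atTop (Set.Icc (-1 : ℝ) 1) := by
  obtain ⟨r, hr, hfr⟩ := exists_hasSum_chebyshev_of_lipschitzOnWith hf
  have hbound (n : ℕ) (k : ℤ) : ‖|r k| * (if k.natAbs ≤ n then (0 : ℝ) else 2)‖ ≤ |r k| * 2 := by
    rw [norm_mul, Real.norm_eq_abs, abs_abs]
    gcongr
    split_ifs <;> simp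
  have htail : Tendsto (fun n : ℕ => ∑' k : ℤ, |r k| * (if k.natAbs ≤ n then (0 : ℝ) else 2))
      atTop (nhds 0) := by
    have := tendsto_tsum_of_dominated_convergence (𝓕 := atTop)
      (f := fun (n : ℕ) (k : ℤ) => |r k| * (if k.natAbs ≤ n then (0 : ℝ) else 2))
      (g := fun _ => 0) (hr.abs.mul_right 2) (fun k => ?_)
      (Eventually.of_forall fun n k => hbound n k)
    · simpa using this
    · refine tendsto_const_nhds.congr' ?_
      filter_upwards [eventually_ge_atTop k.natAbs] with n hn
      simp [hn]
  rw [Metric.tendstoUniformlyOn_iff]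
  intro ε hε
  filter_upwards [htail.eventually_lt_const hε, eventually_ne_atTop 0] with n hlt hn x hx
  refine lt_of_le_of_lt ?_ hlt
  have hsum := (hfr x hx).sub (hasSum_eval_chebInterpolant (n := n) hfr x)
  rw [Real.dist_eq, ← Real.norm_eq_abs, ← hsum.tsum_eq]
  refine tsum_of_norm_bounded
    (Summable.of_norm_bounded (hr.abs.mul_right 2) (hbound n)).hasSum fun k => ?_
  rw [← mul_sub, norm_mul, Real.norm_eq_abs, Real.norm_eq_abs]
  gcongr
  exact abs_eval_chebyshev_T_sub_chebInterpolant_le hn k hx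
end

section
/- Let ν ≥ 1 be a natural number and let f : ℝ → ℝ be ν times continuously differentiable on [-1, 1] with its ν-th derivative of bounded variation on [-1, 1]. For each n ≥ 1 let p_n be the polynomial of degree at most n interpolating f at the n+1 Chebyshev points cos(jπ/n), 0 ≤ j ≤ n. Then there exists a constant C > 0 such that for all n > ν, sup_{x ∈ [-1,1]} |f(x) − p_n(x)| ≤ C · n^{−ν}; i.e. the Chebyshev interpolants converge to f at a polynomial (algebraic) rate of order ν. -/
section

open Set Real MeasureTheory intervalIntegral

theorem BoundedVariationOn.abs_integral_mul_cos_le {G : ℝ → ℝ}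
    (hG : ContinuousOn G (Icc 0 π)) (hbv : BoundedVariationOn G (Icc 0 π)) {k : ℕ} (hk : 0 < k) :
    |∫ θ in (0 : ℝ)..π, G θ * cos (k * θ)| ≤ (eVariationOn G (Icc 0 π)).toReal * (π / k) := by
  have hk' : (0 : ℝ) < k := by exact_mod_cast hk
  set t : ℕ → ℝ := fun j => j * (π / k) with ht
  have htmono : Monotone t := fun i j hij => by simp only [ht]; gcongr
  have ht0 : t 0 = 0 := by simp [ht]
  have htk : t k = π := by simp only [ht]; field_simp
  have hstep (j : ℕ) : t (j + 1) - t j = π / k := by simp only [ht]; push_cast; ring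
  have hsub {j : ℕ} (hj : j < k) : Icc (t j) (t (j + 1)) ⊆ Icc 0 π := by
    rw [← ht0, ← htk]
    exact Icc_subset_Icc (htmono (Nat.zero_le j)) (htmono hj)
  have hintg {j : ℕ} (hj : j < k) :
      IntervalIntegrable (fun θ => G θ * cos (k * θ)) volume (t j) (t (j + 1)) := by
    refine ContinuousOn.intervalIntegrable ?_
    rw [uIcc_of_le (htmono j.le_succ)]
    exact (hG.mono (hsub hj)).mul (by fun_prop)
  have hzero (j : ℕ) : ∫ θ in t j..t (j + 1), cos (k * θ) = 0 := by
    have h1 : (k : ℝ) * t (j + 1) = ((j + 1 : ℕ) : ℝ) * π := by simp only [ht]; field_simp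
    have h2 : (k : ℝ) * t j = (j : ℝ) * π := by simp only [ht]; field_simp
    rw [intervalIntegral.integral_comp_mul_left (fun θ => cos θ) hk'.ne', integral_cos, h1, h2,
      sin_nat_mul_pi, sin_nat_mul_pi]
    simp
  have hpiece {j : ℕ} (hj : j < k) : |∫ θ in t j..t (j + 1), G θ * cos (k * θ)| ≤
      (eVariationOn G (Icc (t j) (t (j + 1)))).toReal * (π / k) := by
    have heq : ∫ θ in t j..t (j + 1), G θ * cos (k * θ) =
        ∫ θ in t j..t (j + 1), (G θ - G (t j)) * cos (k * θ) := by
      simp only [sub_mul]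
      rw [integral_sub (hintg hj) (Continuous.intervalIntegrable (by fun_prop) _ _),
        intervalIntegral.integral_const_mul, hzero, mul_zero, sub_zero]
    rw [heq, ← hstep j, ← abs_of_nonneg (sub_nonneg.2 (htmono j.le_succ)), ← Real.norm_eq_abs]
    refine norm_integral_le_of_norm_le_const fun θ hθ => ?_
    rw [uIoc_of_le (htmono j.le_succ)] at hθ
    rw [norm_mul]
    refine (mul_le_of_le_one_right (norm_nonneg _) (abs_cos_le_one _)).trans ?_
    rw [← dist_eq_norm]
    exact (hbv.mono (hsub hj)).dist_le (Ioc_subset_Icc_self hθ)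
      (left_mem_Icc.2 (htmono j.le_succ))
  calc |∫ θ in (0 : ℝ)..π, G θ * cos (k * θ)|
      = |∑ j ∈ Finset.range k, ∫ θ in t j..t (j + 1), G θ * cos (k * θ)| := by
        rw [sum_integral_adjacent_intervals (a := t) fun j hj => hintg hj, ht0, htk]
    _ ≤ ∑ j ∈ Finset.range k, |∫ θ in t j..t (j + 1), G θ * cos (k * θ)| :=
        Finset.abs_sum_le_sum_abs _ _
    _ ≤ ∑ j ∈ Finset.range k, (eVariationOn G (Icc (t j) (t (j + 1)))).toReal * (π / k) :=
        Finset.sum_le_sum fun j hj => hpiece (Finset.mem_range.1 hj)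
    _ = (eVariationOn G (Icc 0 π)).toReal * (π / k) := by
        rw [← Finset.sum_mul, ← ENNReal.toReal_sum fun j hj =>
          hbv.mono (hsub (Finset.mem_range.1 hj)), eVariationOn.sum' G htmono, ht0, htk]

/-- The unnormalised `k`-th Chebyshev coefficient of `F`, as a cosine moment of `F ∘ cos`. -/
noncomputable def cosMoment (F : ℝ → ℝ) (k : ℕ) : ℝ :=
  ∫ θ in (0 : ℝ)..Real.pi, F (Real.cos θ) * Real.cos (k * θ)

theorem ContinuousOn.comp_cos {F : ℝ → ℝ} (hF : ContinuousOn F (Icc (-1) 1)) :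
    Continuous fun θ => F (cos θ) :=
  hF.comp_continuous continuous_cos cos_mem_Icc

theorem BoundedVariationOn.exists_abs_cosMoment_le {F : ℝ → ℝ} (hF : ContinuousOn F (Icc (-1) 1))
    (hbv : BoundedVariationOn F (Icc (-1) 1)) :
    ∃ C, ∀ k : ℕ, |cosMoment F k| ≤ C / (k + 1) := by
  have hbv' : BoundedVariationOn (F ∘ cos) (Icc 0 π) :=
    ne_top_of_le_ne_top hbv
      (eVariationOn.comp_le_of_antitoneOn F cos strictAntiOn_cos.antitoneOn
        fun θ _ => cos_mem_Icc θ)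
  set V := (eVariationOn (F ∘ cos) (Icc 0 π)).toReal
  have hV : 0 ≤ V := ENNReal.toReal_nonneg
  refine ⟨max |cosMoment F 0| (2 * V * π), fun k => ?_⟩
  rcases k.eq_zero_or_pos with rfl | hk
  · simp
  · have hk' : (1 : ℝ) ≤ k := by exact_mod_cast hk
    calc |cosMoment F k| ≤ V * (π / k) :=
          hbv'.abs_integral_mul_cos_le hF.comp_cos.continuousOn hk
      _ = 2 * V * π / (2 * k) := by field_simp
      _ ≤ 2 * V * π / (k + 1) := by
          have := pi_pos
          gcongr
          linarith
      _ ≤ _ := by gcongr; exact le_max_right _ _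

theorem succ_mul_cosMoment_succ {F F' : ℝ → ℝ} (hF : ContinuousOn F (Icc (-1) 1))
    (hF' : ContinuousOn F' (Icc (-1) 1)) (hderiv : ∀ x ∈ Ioo (-1) 1, HasDerivAt F (F' x) x)
    (k : ℕ) :
    (k + 1) * cosMoment F (k + 1) = (cosMoment F' k - cosMoment F' (k + 2)) / 2 := by
  have hcos {θ : ℝ} (hθ : θ ∈ Ioo 0 π) : cos θ ∈ Ioo (-1 : ℝ) 1 := by
    rw [← cos_pi, ← cos_zero]
    exact ⟨strictAntiOn_cos (Ioo_subset_Icc_self hθ) (right_mem_Icc.2 pi_pos.le) hθ.2,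
      strictAntiOn_cos (left_mem_Icc.2 pi_pos.le) (Ioo_subset_Icc_self hθ) hθ.1⟩
  have hcF' := hF'.comp_cos
  have hparts := intervalIntegral.integral_mul_deriv_eq_deriv_mul_of_hasDerivAt (a := 0) (b := π)
    (u := fun θ => F (cos θ)) (u' := fun θ => F' (cos θ) * (-sin θ))
    (v := fun θ => sin (((k + 1 : ℕ) : ℝ) * θ))
    (v' := fun θ => cos (((k + 1 : ℕ) : ℝ) * θ) * (k + 1 : ℕ))
    hF.comp_cos.continuousOn (by fun_prop)
    (fun θ hθ => by
      rw [min_eq_left pi_pos.le, max_eq_right pi_pos.le] at hθ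
      exact (hderiv _ (hcos hθ)).comp θ (hasDerivAt_cos θ))
    (fun θ _ => by simpa using ((hasDerivAt_id θ).const_mul ((k + 1 : ℕ) : ℝ)).sin)
    (hcF'.mul continuous_sin.neg |>.intervalIntegrable _ _)
    (Continuous.intervalIntegrable (by fun_prop) _ _)
  rw [sin_nat_mul_pi] at hparts
  simp only [mul_zero, sin_zero, sub_zero, zero_sub] at hparts
  have hintg (c : ℝ) : IntervalIntegrable (fun θ => F' (cos θ) * cos (c * θ)) volume 0 π :=
    (hcF'.mul (by fun_prop)).intervalIntegrable _ _
  unfold cosMoment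
  rw [← intervalIntegral.integral_sub (hintg _) (hintg _), ← intervalIntegral.integral_div,
    ← intervalIntegral.integral_const_mul]
  calc _ = ∫ θ in (0 : ℝ)..π, F (cos θ) * (cos (((k + 1 : ℕ) : ℝ) * θ) * (k + 1 : ℕ)) := by
        congr 1 with θ
        push_cast
        ring
    _ = _ := by
        rw [hparts, ← intervalIntegral.integral_neg]
        congr 1 with θ
        have h1 : (k : ℝ) * θ = ((k + 1 : ℕ) : ℝ) * θ - θ := by push_cast; ring
        have h2 : ((k + 2 : ℕ) : ℝ) * θ = ((k + 1 : ℕ) : ℝ) * θ + θ := by push_cast; ring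
        rw [h1, h2, cos_add, cos_sub]
        ring

theorem ContDiffOn.exists_abs_cosMoment_le {m : ℕ} {F : ℝ → ℝ}
    (hF : ContDiffOn ℝ m F (Icc (-1) 1))
    (hbv : BoundedVariationOn (iteratedDerivWithin m F (Icc (-1) 1)) (Icc (-1) 1)) :
    ∃ C, ∀ k : ℕ, |cosMoment F k| ≤ C / (k + 1) ^ (m + 1) := by
  induction m generalizing F with
  | zero =>
    simpa using BoundedVariationOn.exists_abs_cosMoment_le hF.continuousOn (by simpa using hbv)
  | succ m ih =>
    rw [iteratedDerivWithin_succ'] at hbv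
    have hF2 := hF
    rw [Nat.cast_succ, contDiffOn_succ_iff_derivWithin (uniqueDiffOn_Icc (by norm_num))] at hF2
    obtain ⟨hdiff, -, hF'⟩ := hF2
    obtain ⟨C, hC⟩ := ih hF' hbv
    have hC0 : 0 ≤ C := by simpa using (abs_nonneg _).trans (hC 0)
    refine ⟨max |cosMoment F 0| (2 ^ (m + 2) * C), fun k => ?_⟩
    rcases k with _ | k
    · simp
    · have hrec := succ_mul_cosMoment_succ hF.continuousOn hF'.continuousOn
        (fun x hx => (hdiff x (Ioo_subset_Icc_self hx)).hasDerivWithinAt.hasDerivAt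
          (Icc_mem_nhds hx.1 hx.2)) k
      have hk : (0 : ℝ) < k + 1 := by positivity
      have h2 : |cosMoment (derivWithin F (Icc (-1) 1)) (k + 2)| ≤ C / (k + 1) ^ (m + 1) := by
        refine (hC (k + 2)).trans ?_
        gcongr
        linarith
      have hmul : (k + 1) * |cosMoment F (k + 1)| ≤ C / (k + 1) ^ (m + 1) := by
        rw [← abs_of_pos hk, ← abs_mul, abs_of_pos hk, hrec, abs_div, abs_two]
        have := abs_sub (cosMoment (derivWithin F (Icc (-1) 1)) k)
          (cosMoment (derivWithin F (Icc (-1) 1)) (k + 2))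
        linarith [hC k]
      calc |cosMoment F (k + 1)| ≤ C / (k + 1) ^ (m + 1) / (k + 1) := by
            rwa [le_div_iff₀' hk]
        _ = 2 ^ (m + 2) * C / (2 * (k + 1)) ^ (m + 2) := by
            rw [mul_pow, div_div, ← pow_succ]
            field_simp
        _ ≤ 2 ^ (m + 2) * C / (((k + 1 : ℕ) : ℝ) + 1) ^ (m + 1 + 1) := by
            gcongr
            push_cast
            linarith
        _ ≤ _ := by gcongr; exact le_max_right _ _

theorem integral_neg_pi_pi_cos_mul_exp {F : ℝ → ℝ} (hF : ContinuousOn F (Icc (-1) 1)) (n : ℤ) :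
    ∫ θ in (-π)..π, Complex.exp (n * θ * Complex.I) * (F (cos θ) : ℂ) =
      2 * cosMoment F n.natAbs := by
  have hc : Continuous fun θ : ℝ => (F (cos θ) : ℂ) :=
    Complex.continuous_ofReal.comp hF.comp_cos
  have hintg (a b : ℝ) : IntervalIntegrable
      (fun θ : ℝ => Complex.exp (n * θ * Complex.I) * (F (cos θ) : ℂ)) volume a b :=
    (Continuous.mul (by fun_prop) hc).intervalIntegrable _ _
  have hintg' (a b : ℝ) : IntervalIntegrable
      (fun θ : ℝ => Complex.exp (n * (-θ : ℝ) * Complex.I) * (F (cos (-θ)) : ℂ)) volume a b :=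
    (Continuous.mul (by fun_prop) (hc.comp continuous_neg)).intervalIntegrable _ _
  have hneg := intervalIntegral.integral_comp_neg (a := 0) (b := π)
    fun θ : ℝ => Complex.exp (n * θ * Complex.I) * (F (cos θ) : ℂ)
  rw [neg_zero] at hneg
  rw [← intervalIntegral.integral_add_adjacent_intervals (hintg _ 0) (hintg _ _), ← hneg,
    ← intervalIntegral.integral_add (hintg' _ _) (hintg _ _), cosMoment,
    ← intervalIntegral.integral_ofReal, ← intervalIntegral.integral_const_mul]
  congr 1 with θ
  have habs : cos (n.natAbs * θ) = cos (n * θ) := by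
    rw [Nat.cast_natAbs, Int.cast_abs]
    rcases abs_choice (n : ℝ) with h | h <;> simp [h]
  rw [habs, cos_neg]
  push_cast
  rw [mul_left_comm, Complex.two_cos]
  ring_nf

theorem fourierCoeff_comp_cos [Fact (0 < 2 * π)] {F : ℝ → ℝ} (hF : ContinuousOn F (Icc (-1) 1))
    {g : AddCircle (2 * π) → ℂ} (hg : ∀ θ : ℝ, g θ = F (cos θ)) (n : ℤ) :
    fourierCoeff g n = (cosMoment F n.natAbs / π : ℝ) := by
  rw [fourierCoeff_eq_intervalIntegral g n (-π), show -π + 2 * π = π by ring]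
  have h := integral_neg_pi_pi_cos_mul_exp hF (-n)
  rw [Int.natAbs_neg] at h
  calc _ = (1 / (2 * π)) • ∫ θ in (-π)..π,
        Complex.exp ((-n : ℤ) * θ * Complex.I) * (F (cos θ) : ℂ) := by
        congr 2 with θ
        rw [fourier_coe_apply, hg, smul_eq_mul]
        congr 2
        have : (π : ℂ) ≠ 0 := by exact_mod_cast pi_ne_zero
        push_cast
        field_simp
    _ = _ := by
        rw [h, Complex.real_smul]
        push_cast
        field_simp

/-- The Chebyshev series of `F`, evaluated at `cos θ`. -/
theorem hasSum_cosMoment {F : ℝ → ℝ} (hF : ContinuousOn F (Icc (-1) 1))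
    (hsum : Summable (cosMoment F)) (θ : ℝ) :
    HasSum (fun k : ℕ => (if k = 0 then 1 else 2) / π * cosMoment F k * cos (k * θ))
      (F (cos θ)) := by
  have : Fact (0 < 2 * π) := ⟨two_pi_pos⟩
  have hper : Function.Periodic (fun θ : ℝ => (F (cos θ) : ℂ)) (2 * π) := fun θ => by
    simp only [cos_add_two_pi]
  let g : C(AddCircle (2 * π), ℂ) := ⟨hper.lift,
    continuous_coinduced_dom.2 (Complex.continuous_ofReal.comp hF.comp_cos)⟩
  have hg (θ : ℝ) : g θ = F (cos θ) := hper.lift_coe θ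
  have hcoef := fourierCoeff_comp_cos hF hg
  have hsummable : Summable (fourierCoeff g) := by
    rw [show fourierCoeff g = _ from funext hcoef]
    have hR : Summable fun k : ℕ => ((cosMoment F k / π : ℝ) : ℂ) :=
      Complex.summable_ofReal.2 (hsum.div_const π)
    refine Summable.of_nat_of_neg ?_ ?_ <;> simpa using hR
  have h := (has_pointwise_sum_fourier_series_of_summable hsummable (θ : AddCircle (2 * π)))
    |>.nat_add_neg
  have h0 : HasSum (fun k : ℕ => if k = 0 then cosMoment F 0 / π else 0) (cosMoment F 0 / π) :=
    hasSum_ite_eq 0 _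
  have hre := (Complex.hasSum_re h).sub h0
  have hfour (n : ℤ) : (fourier n (θ : AddCircle (2 * π))).re = cos (n * θ) := by
    have hpi : (π : ℂ) ≠ 0 := by exact_mod_cast pi_ne_zero
    rw [fourier_coe_apply, ← Complex.exp_ofReal_mul_I_re]
    congr 2
    push_cast
    field_simp
  have hval : (g θ + fourierCoeff g 0 • fourier 0 (θ : AddCircle (2 * π))).re -
      cosMoment F 0 / π = F (cos θ) := by
    rw [hg, hcoef]
    simp
  rw [hval] at hre
  refine hre.congr_fun fun k => ?_
  rw [hcoef, hcoef, smul_eq_mul, smul_eq_mul, Complex.add_re, Complex.re_ofReal_mul,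
    Complex.re_ofReal_mul, hfour, hfour, Int.natAbs_neg, Int.natAbs_natCast]
  rcases eq_or_ne k 0 with rfl | hk
  · simp
    ring
  · simp [hk]
    ring

theorem injOn_cos_mul_pi_div {n : ℕ} (hn : 0 < n) :
    InjOn (fun j : ℕ => cos ((j : ℝ) * π / n)) (Finset.range (n + 1)) := by
  have hn' : (0 : ℝ) < n := by exact_mod_cast hn
  have hmem {j : ℕ} (hj : j ∈ Finset.range (n + 1)) : (j : ℝ) * π / n ∈ Icc 0 π := by
    have hj' : (j : ℝ) ≤ n := by exact_mod_cast Finset.mem_range_succ_iff.1 hj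
    refine ⟨by positivity, ?_⟩
    rw [div_le_iff₀ hn', mul_comm]
    gcongr
  intro i hi j hj hij
  have h := injOn_cos (hmem hi) (hmem hj) hij
  rw [div_left_inj' hn'.ne', mul_left_inj' pi_ne_zero] at h
  exact_mod_cast h

theorem chebInterpolant_T_of_le {k n : ℕ} (hn : 0 < n) (hk : k ≤ n) :
    chebInterpolant n (fun x => (Polynomial.Chebyshev.T ℝ k).eval x) =
      Polynomial.Chebyshev.T ℝ k := by
  refine (Lagrange.eq_interpolate (injOn_cos_mul_pi_div hn) ?_).symm
  rw [Polynomial.Chebyshev.degree_T, Finset.card_range, Int.natAbs_natCast]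
  exact_mod_cast Nat.lt_succ_of_le hk

/-- On the grid `jπ/n`, every cosine `cos (kθ)` coincides with one of frequency at most `n`. -/
theorem exists_le_cos_mul_grid_eq {n : ℕ} (hn : 0 < n) (k : ℕ) :
    ∃ m ≤ n, ∀ j : ℕ, cos (k * (j * π / n)) = cos (m * (j * π / n)) := by
  have hn' : (n : ℝ) ≠ 0 := by exact_mod_cast hn.ne'
  have hk : (k : ℝ) = 2 * n * (k / (2 * n) : ℕ) + (k % (2 * n) : ℕ) := by
    exact_mod_cast (Nat.div_add_mod k (2 * n)).symm
  have hmod (j : ℕ) : cos (k * (j * π / n)) = cos ((k % (2 * n) : ℕ) * (j * π / n)) := by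
    rw [← cos_add_nat_mul_two_pi ((k % (2 * n) : ℕ) * (j * π / n)) (k / (2 * n) * j)]
    congr 1
    nth_rw 1 [hk]
    push_cast
    field_simp
    ring
  have hlt : k % (2 * n) < 2 * n := Nat.mod_lt _ (by positivity)
  rcases le_total (k % (2 * n)) n with h | h
  · exact ⟨_, h, hmod⟩
  · refine ⟨2 * n - k % (2 * n), by omega, fun j => ?_⟩
    rw [hmod, Nat.cast_sub hlt.le, ← cos_nat_mul_two_pi_sub _ j]
    congr 1
    push_cast
    field_simp

theorem exists_le_chebInterpolant_T_eq {n : ℕ} (hn : 0 < n) (k : ℕ) :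
    ∃ m ≤ n, chebInterpolant n (fun x => (Polynomial.Chebyshev.T ℝ k).eval x) =
      Polynomial.Chebyshev.T ℝ m := by
  obtain ⟨m, hm, h⟩ := exists_le_cos_mul_grid_eq hn k
  refine ⟨m, hm, ?_⟩
  rw [← chebInterpolant_T_of_le hn hm]
  refine Lagrange.interpolate_eq_of_values_eq_on _ _ fun j _ => ?_
  simpa only [Polynomial.Chebyshev.T_real_cos, Int.cast_natCast] using h j

theorem abs_T_sub_chebInterpolant_T_le {n : ℕ} (hn : 0 < n) (k : ℕ) {x : ℝ}
    (hx : x ∈ Icc (-1 : ℝ) 1) :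
    |(Polynomial.Chebyshev.T ℝ k).eval x -
      (chebInterpolant n (fun y => (Polynomial.Chebyshev.T ℝ k).eval y)).eval x| ≤ 2 := by
  obtain ⟨m, -, h⟩ := exists_le_chebInterpolant_T_eq hn k
  have hT (l : ℕ) : |(Polynomial.Chebyshev.T ℝ l).eval x| ≤ 1 :=
    Polynomial.Chebyshev.abs_eval_T_real_le_one l (abs_le.2 hx)
  rw [h]
  refine (abs_sub _ _).trans ?_
  linarith [hT k, hT m]

theorem hasSum_sub_eval_chebInterpolant {f : ℝ → ℝ} {b : ℕ → ℝ}
    (hf : ∀ x ∈ Icc (-1 : ℝ) 1,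
      HasSum (fun k : ℕ => b k * (Polynomial.Chebyshev.T ℝ k).eval x) (f x))
    (n : ℕ) {x : ℝ} (hx : x ∈ Icc (-1 : ℝ) 1) :
    HasSum (fun k : ℕ => b k * ((Polynomial.Chebyshev.T ℝ k).eval x -
      (chebInterpolant n (fun y => (Polynomial.Chebyshev.T ℝ k).eval y)).eval x))
      (f x - (chebInterpolant n f).eval x) := by
  simp only [mul_sub]
  refine (hf x hx).sub ?_
  simp only [chebInterpolant, Lagrange.interpolate_apply, Polynomial.eval_finsetSum,
    Polynomial.eval_mul, Polynomial.eval_C, Finset.mul_sum, ← mul_assoc]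
  exact hasSum_sum fun j _ => (hf _ (cos_mem_Icc _)).mul_right _

theorem HasSum.abs_le_of_telescoping {e : ℕ → ℝ} {s D : ℝ} {n : ℕ} (hn : 0 < n)
    (he : HasSum e s) (h0 : ∀ k ≤ n, e k = 0)
    (hle : ∀ k, n < k → |e k| ≤ D / (k * (k + 1))) (hD : 0 ≤ D) : |s| ≤ D / n := by
  have hpart (N : ℕ) : |∑ k ∈ Finset.range (N + (n + 1)), e k| ≤ D / n - D / (N + n + 1) := by
    induction N with
    | zero =>
      rw [Finset.sum_eq_zero fun k hk => h0 k (by simpa [Nat.lt_succ_iff] using hk), abs_zero,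
        sub_nonneg]
      gcongr
      push_cast
      linarith
    | succ N ih =>
      rw [show N + 1 + (n + 1) = N + (n + 1) + 1 by ring, Finset.sum_range_succ]
      refine (abs_add_le _ _).trans ((add_le_add ih (hle _ (by omega))).trans_eq ?_)
      push_cast
      field_simp
      ring
  refine le_of_tendsto (((Filter.tendsto_add_atTop_iff_nat (n + 1)).2 he.tendsto_sum_nat).abs)
    (Filter.Eventually.of_forall fun N => (hpart N).trans ?_)
  rw [sub_le_self_iff]
  positivity

theorem abs_sub_eval_chebInterpolant_le {f : ℝ → ℝ} {b : ℕ → ℝ} {ν : ℕ} {C : ℝ} (hν : 1 ≤ ν)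
    (hf : ∀ x ∈ Icc (-1 : ℝ) 1,
      HasSum (fun k : ℕ => b k * (Polynomial.Chebyshev.T ℝ k).eval x) (f x))
    (hb : ∀ k : ℕ, |b k| ≤ C / (k + 1) ^ (ν + 1)) {n : ℕ} (hn : 0 < n) {x : ℝ}
    (hx : x ∈ Icc (-1 : ℝ) 1) :
    |f x - (chebInterpolant n f).eval x| ≤ 2 * C / n ^ ν := by
  obtain ⟨μ, rfl⟩ := Nat.exists_eq_add_of_le' hν
  have hn' : (0 : ℝ) < n := by exact_mod_cast hn
  have hC : 0 ≤ C := by simpa using (abs_nonneg _).trans (hb 0)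
  have h := (hasSum_sub_eval_chebInterpolant hf n hx).abs_le_of_telescoping (D := 2 * C / n ^ μ) hn
    (fun k hk => by rw [chebInterpolant_T_of_le hn hk, sub_self, mul_zero])
    (fun k hk => ?_) (by positivity)
  · rwa [div_div, ← pow_succ] at h
  · have hk' : (n : ℝ) ≤ k := by exact_mod_cast hk.le
    have hk0 : (0 : ℝ) < k := hn'.trans_le hk'
    rw [abs_mul, div_div]
    calc _ ≤ C / (k + 1) ^ (μ + 1 + 1) * 2 := by
          gcongr
          · exact hb k
          · exact abs_T_sub_chebInterpolant_T_le hn k hx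
      _ = 2 * C / ((k + 1) ^ μ * ((k + 1) * (k + 1))) := by ring
      _ ≤ _ := by
          gcongr <;> linarith

theorem ContDiffOn.exists_hasSum_T {ν : ℕ} {f : ℝ → ℝ} (hν : 1 ≤ ν)
    (hf : ContDiffOn ℝ ν f (Icc (-1) 1))
    (hbv : BoundedVariationOn (iteratedDerivWithin ν f (Icc (-1) 1)) (Icc (-1) 1)) :
    ∃ (b : ℕ → ℝ) (C : ℝ), (∀ k, |b k| ≤ C / (k + 1) ^ (ν + 1)) ∧ ∀ x ∈ Icc (-1 : ℝ) 1,
      HasSum (fun k : ℕ => b k * (Polynomial.Chebyshev.T ℝ k).eval x) (f x) := by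
  obtain ⟨C, hC⟩ := hf.exists_abs_cosMoment_le hbv
  have hsum : Summable (cosMoment f) := by
    refine Summable.of_norm_bounded (g := fun k : ℕ => C / ((k : ℝ) + 1) ^ (ν + 1)) ?_ hC
    have := (summable_nat_add_iff 1).2 (Real.summable_one_div_nat_pow.2 (by omega : 1 < ν + 1))
    simpa [div_eq_mul_inv] using this.mul_left C
  refine ⟨fun k => (if k = 0 then 1 else 2) / π * cosMoment f k, 2 / π * C, fun k => ?_,
    fun x hx => ?_⟩
  · have hπ := pi_pos
    rw [abs_mul, mul_div_assoc]
    refine mul_le_mul ?_ (hC k) (abs_nonneg _) (by positivity)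
    rw [abs_div, abs_of_pos hπ]
    gcongr
    split_ifs <;> norm_num
  · have h := hasSum_cosMoment hf.continuousOn hsum (arccos x)
    simpa only [← Int.cast_natCast (R := ℝ), ← Polynomial.Chebyshev.T_real_cos,
      cos_arccos hx.1 hx.2] using h

end

/-- If `f : ℝ → ℝ` is `ν` times continuously differentiable on `[-1, 1]`
(`ν ≥ 1`) with `ν`-th derivative of bounded variation on `[-1, 1]`, then there
is `C > 0` such that for all `n > ν` the Chebyshev interpolant `p_n` satisfies
`sup_{x ∈ [-1,1]} |f(x) − p_n(x)| ≤ C n^{−ν}`: algebraic convergence of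
order `ν`. -/
theorem chebyshev_interpolation_algebraic_convergence
    (ν : ℕ) (hν : 1 ≤ ν) (f : ℝ → ℝ)
    (hf : ContDiffOn ℝ ν f (Set.Icc (-1 : ℝ) 1))
    (hbv : BoundedVariationOn (iteratedDerivWithin ν f (Set.Icc (-1 : ℝ) 1))
      (Set.Icc (-1 : ℝ) 1)) :
    ∃ C : ℝ, 0 < C ∧ ∀ n : ℕ, ν < n → ∀ x : ℝ, x ∈ Set.Icc (-1 : ℝ) 1 →
      |f x - (chebInterpolant n f).eval x| ≤ C * (n : ℝ) ^ (-(ν : ℝ)) := by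
  obtain ⟨b, C, hb, hsum⟩ := hf.exists_hasSum_T hν hbv
  refine ⟨max 1 (2 * C), by positivity, fun n hn x hx => ?_⟩
  rw [Real.rpow_neg n.cast_nonneg, Real.rpow_natCast, ← div_eq_mul_inv]
  refine (abs_sub_eval_chebInterpolant_le hν hsum hb (by omega) hx).trans ?_
  gcongr
  exact le_max_right _ _
end
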